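/- Equip the interval (0,1) with Lebesgue measure and let ℓ²(0,1) denote the Hilbert space of square-summable functions φ: (0,1) → ℝ (i.e., ‖φ‖² = sup over finite subsets U of (0,1) of Σ_{t∈U} |φ(t)|² < ∞). Then there is no strongly measurable function f: (0,1) → ℓ²(0,1) such that |(f(t))(t)| ≥ 1/2 for almost all t ∈ (0,1). (In particular, the pointwise-evaluation family Φ(t)φ := φ(t), which satisfies ‖Φ(t)‖ = 1 and has measurable orbits t ↦ Φ(t)φ for every φ, is not strongly normable with ε = 1/2.) -/

import Mathlib

open MeasureTheory

/-- Example 2.10 of Blasco–van Neerven.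
There is no strongly measurable function `f : (0,1) → ℓ²(0,1)` (with respect to
Lebesgue measure on `(0,1)`) such that `|(f t) t| ≥ 1/2` for almost all `t ∈ (0,1)`. -/
theorem no_strongly_measurable_diagonal_selector :
    ¬ ∃ f : ↥(Set.Ioo (0:ℝ) 1) → lp (fun _ : ↥(Set.Ioo (0:ℝ) 1) => ℝ) 2,
      AEStronglyMeasurable f ((volume : Measure ℝ).comap Subtype.val) ∧
      ∀ᵐ t ∂((volume : Measure ℝ).comap Subtype.val),
        (1:ℝ)/2 ≤ |(f t : ∀ _ : ↥(Set.Ioo (0:ℝ) 1), ℝ) t| := by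
  rintro ⟨f, hf, h⟩
  obtain ⟨g, hg, hfg⟩ := hf
  obtain ⟨c, hc, hcl⟩ := hg.isSeparable_range
  have hsupp : ∀ d : lp (fun _ : ↥(Set.Ioo (0:ℝ) 1) => ℝ) 2,
      (Function.support (d : ∀ _ : ↥(Set.Ioo (0:ℝ) 1), ℝ)).Countable := by
    intro d
    have h1 := (lp.memℓp d).summable (by norm_num)
    refine h1.countable_support.mono ?_
    intro t ht
    simpa using ht
  have hS : (⋃ d ∈ c, Function.support (d : ∀ _ : ↥(Set.Ioo (0:ℝ) 1), ℝ)).Countable :=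
    hc.biUnion fun d _ => hsupp d
  set S := ⋃ d ∈ c, Function.support (d : ∀ _ : ↥(Set.Ioo (0:ℝ) 1), ℝ) with hSdef
  have hS0 : ((volume : Measure ℝ).comap Subtype.val) S = 0 := by
    rw [comap_subtype_coe_apply measurableSet_Ioo]
    exact (hS.image _).measure_zero _
  have hSae : ∀ᵐ t ∂((volume : Measure ℝ).comap (Subtype.val : ↥(Set.Ioo (0:ℝ) 1) → ℝ)), t ∉ S :=
    measure_eq_zero_iff_ae_notMem.1 hS0
  have hF : ∀ᵐ t ∂((volume : Measure ℝ).comap (Subtype.val : ↥(Set.Ioo (0:ℝ) 1) → ℝ)), False := by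
    filter_upwards [h, hfg, hSae] with t h1 h2 h3
    rw [h2] at h1
    obtain ⟨d, hd, hdist⟩ := Metric.mem_closure_iff.1 (hcl ⟨t, rfl⟩) (1/2) (by norm_num)
    have hdt : (d : ∀ _ : ↥(Set.Ioo (0:ℝ) 1), ℝ) t = 0 := by
      by_contra hne
      exact h3 (Set.mem_biUnion hd hne)
    have h4 := lp.norm_apply_le_norm (p := 2) (by norm_num) (g t - d) t
    rw [dist_eq_norm] at hdist
    rw [lp.coeFn_sub, Pi.sub_apply, hdt, sub_zero, Real.norm_eq_abs] at h4
    linarith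
  rw [Filter.eventually_false_iff_eq_bot, ae_eq_bot] at hF
  have h5 : ((volume : Measure ℝ).comap (Subtype.val : ↥(Set.Ioo (0:ℝ) 1) → ℝ)) Set.univ = 0 := by
    rw [hF]; rfl
  rw [comap_subtype_coe_apply measurableSet_Ioo] at h5
  rw [Set.image_univ, Subtype.range_coe, Real.volume_Ioo] at h5
  simp at h5
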